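/- Let Θ ⊆ I, let w₁ ∈ W^{Θ∪Θ^⊥}, w₂ ∈ ^ΘW, and i ∈ I. For a ∼_Θ-class c, let l₊₊(c) := ℓ(a) − ℓ(b), where (a,b) is the unique representative of c with a ∈ W^Θ, b ∈ ^{Θ∪Θ^⊥}W. Write c for the class of (w₁, w₂), c' for the class of (w₁, w₂σ_i), and r := w₂σ_i w₂⁻¹. Then: (a) if either (ℓ(w₂σ_i) = ℓ(w₂) − 1 and r ∉ W_{Θ∪Θ^⊥}) or (ℓ(w₂σ_i) = ℓ(w₂) + 1 and r ∈ W_{Θ^⊥}), then l₊₊(c') = l₊₊(c) + 1; (b) if r ∈ W_Θ, then l₊₊(c') = l₊₊(c); (c) if either (ℓ(w₂σ_i) = ℓ(w₂) + 1 and r ∉ W_{Θ∪Θ^⊥}) or (ℓ(w₂σ_i) = ℓ(w₂) − 1 and r ∈ W_{Θ^⊥}), then l₊₊(c') = l₊₊(c) − 1. Moreover l₊₊(c') = l₊₊(c) if and only if c' = c. -/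

import Mathlib

open Classical

namespace Paper

variable {B : Type*} {M : CoxeterMatrix B} {W : Type*} [Group W]

/-- `Θ^⊥`: the indices whose simple reflections commute with all simple
reflections indexed by `Θ` (i.e. `m(i,j) = 2` for all `j ∈ Θ`). -/
def perp (M : CoxeterMatrix B) (Θ : Set B) : Set B := {i | i ∉ Θ ∧ ∀ j ∈ Θ, M i j = 2}

variable (cs : CoxeterSystem M W)

/-- The standard parabolic subgroup `W_J` generated by the simple reflections indexed by `J`. -/
def parabolic (J : Set B) : Subgroup W := Subgroup.closure (cs.simple '' J)

/-- `W^J`: the minimal-length representatives of the cosets `W/W_J`,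
`{w : ℓ(wu) = ℓ(w) + ℓ(u) for all u ∈ W_J}`. -/
def minRight (J : Set B) : Set W :=
  {w | ∀ u ∈ parabolic cs J, cs.length (w * u) = cs.length w + cs.length u}

/-- `^JW`: the minimal-length representatives of the cosets `W_J\W`,
`{w : ℓ(uw) = ℓ(u) + ℓ(w) for all u ∈ W_J}`. -/
def minLeft (J : Set B) : Set W :=
  {w | ∀ u ∈ parabolic cs J, cs.length (u * w) = cs.length u + cs.length w}

/-- The Bruhat order on `W`: `x ≤ y` iff `y` is obtained from `x` by a chain of
right multiplications by reflections, each strictly increasing the length. -/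
def bruhatLE : W → W → Prop :=
  Relation.ReflTransGen (fun x y => ∃ t, cs.IsReflection t ∧ y = x * t ∧ cs.length x < cs.length y)

/-- The equivalence relation `∼_Θ` on `W × W`:
`(x,y) ∼_Θ (x',y')` iff there are `u ∈ W_{Θ∪Θ^⊥}` and `v ∈ W_Θ` with `x' = xu`, `y' = u⁻¹vy`. -/
def simRel (Θ : Set B) (p q : W × W) : Prop :=
  ∃ u ∈ parabolic cs (Θ ∪ perp M Θ), ∃ v ∈ parabolic cs Θ,
    q.1 = p.1 * u ∧ q.2 = u⁻¹ * v * p.2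

/-- `w^J`: the minimal-length element of the coset `w W_J`. -/
noncomputable def projR (J : Set B) (w : W) : W :=
  if h : ∃ a, a ∈ minRight cs J ∧ a⁻¹ * w ∈ parabolic cs J then h.choose else w

/-- `^Jw`: the minimal-length element of the coset `W_J w`. -/
noncomputable def projL (J : Set B) (w : W) : W :=
  if h : ∃ a, a ∈ minLeft cs J ∧ w * a⁻¹ ∈ parabolic cs J then h.choose else w

section Representation

/-! ### The geometric representation and injectivity of the simple reflections -/

variable {A : Type*} (N : CoxeterMatrix A)

/-- Twice the cosine of `π / m`, as a complex number. -/
noncomputable def twoCos (m : ℕ) : ℂ :=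
  Complex.exp (Real.pi * Complex.I / m) + Complex.exp (-(Real.pi * Complex.I / m))

lemma twoCos_two : twoCos 2 = 0 := by
  have h : (Real.pi * Complex.I / (2 : ℕ) : ℂ) = Real.pi / 2 * Complex.I := by push_cast; ring
  rw [twoCos, h, Complex.exp_neg, Complex.exp_pi_div_two_mul_I, Complex.inv_I]
  ring

/-- The vector by which the `i`-th simple reflection translates in the geometric representation. -/
noncomputable def geomVec (i : A) : A → ℂ := fun j => if i = j then -2 else twoCos (N i j)

/-- The `i`-th simple reflection of the (dual) geometric representation. -/
noncomputable def geomRefl (i : A) : Module.End ℂ (A → ℂ) where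
  toFun x := x + x i • geomVec N i
  map_add' x y := by ext j; simp; ring
  map_smul' c x := by ext j; simp; ring

lemma geomRefl_apply (i j : A) (x : A → ℂ) :
    geomRefl N i x j = x j + x i * (if i = j then -2 else twoCos (N i j)) := rfl

lemma geomRefl_mul_self (i : A) : geomRefl N i * geomRefl N i = 1 := by
  ext1 x
  ext1 j
  simp only [Module.End.mul_apply, geomRefl_apply, Module.End.one_apply, if_true]
  ring

/-- If `ζ` is a primitive `m`-th root of unity with `m ≥ 3`, then an endomorphism annihilated
by `(X - 1) (X² - (ζ + ζ⁻¹) X + 1)` has `m`-th power one. -/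
lemma pow_eq_one_of_cubic {V : Type*} [AddCommGroup V] [Module ℂ V] (R : Module.End ℂ V)
    {m : ℕ} (hm : 3 ≤ m) {ζ : ℂ} (hζ : IsPrimitiveRoot ζ m)
    (h : (R - 1) * (R * R - (ζ + ζ⁻¹) • R + 1) = 0) : R ^ m = 1 := by
  open Polynomial in
  have hζ0 : ζ ≠ 0 := hζ.ne_zero (by omega)
  have h1 : ζ ≠ 1 := hζ.ne_one (by omega)
  have h2 : ζ⁻¹ ≠ 1 := by simpa using h1
  have h3 : ζ ≠ ζ⁻¹ := by
    intro h
    have h' : ζ ^ 2 = 1 := by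
      rw [pow_two]; nth_rw 2 [h]; exact mul_inv_cancel₀ hζ0
    have := Nat.le_of_dvd (by norm_num) (hζ.dvd_of_pow_eq_one 2 h')
    omega
  have cop : ∀ {a b : ℂ}, a ≠ b → IsCoprime (X - C a : ℂ[X]) (X - C b) := fun hab =>
    isCoprime_X_sub_C_of_isUnit_sub (sub_ne_zero.mpr hab).isUnit
  have root : ∀ {a : ℂ}, a ^ m = 1 → (X - C a : ℂ[X]) ∣ X ^ m - 1 := fun ha => by
    rw [dvd_iff_isRoot]; simp [ha]
  have hdvd : ((X - C 1) * ((X - C ζ) * (X - C ζ⁻¹)) : ℂ[X]) ∣ X ^ m - 1 :=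
    IsCoprime.mul_dvd (IsCoprime.mul_right (cop h1.symm) (cop h2.symm)) (root (one_pow m))
      (IsCoprime.mul_dvd (cop h3) (root hζ.pow_eq_one) (root (by simp [hζ.pow_eq_one])))
  have hpoly : ((X - C 1) * ((X - C ζ) * (X - C ζ⁻¹)) : ℂ[X]) =
      (X - 1) * (X * X - C (ζ + ζ⁻¹) * X + 1) := by
    have : (C ζ * C ζ⁻¹ : ℂ[X]) = 1 := by rw [← C_mul, mul_inv_cancel₀ hζ0, C_1]
    rw [C_1, C_add]
    linear_combination (X - 1) * this
  obtain ⟨q, hq⟩ := hdvd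
  rw [hpoly] at hq
  have := congrArg (aeval R) hq
  simp only [map_mul, map_sub, map_add, aeval_X, aeval_C, map_one, map_pow] at this
  rw [← map_add, ← Algebra.smul_def, h, zero_mul, sub_eq_zero] at this
  exact this

lemma geomRefl_isLiftable : N.IsLiftable (geomRefl N) := by
  intro i j
  by_cases hij : i = j
  · subst hij
    rw [geomRefl_mul_self, one_pow]
  have hji : ¬ j = i := fun h => hij h.symm
  have hsymm : N j i = N i j := N.symmetric j i
  have hne : N i j ≠ 1 := fun h => hij (by by_contra h'; exact N.off_diagonal i j h' h)
  rcases Nat.lt_or_ge (N i j) 3 with hlt | hge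
  · have : N i j = 0 ∨ N i j = 2 := by omega
    rcases this with h | h
    · rw [h, pow_zero]
    · rw [h, pow_two]
      ext1 x
      ext1 k
      simp only [Module.End.mul_apply, geomRefl_apply, Module.End.one_apply, if_true,
        if_neg hij, if_neg hji, hsymm, h, twoCos_two]
      ring
  · set m := N i j with hm
    set η := Complex.exp (Real.pi * Complex.I / m) with hη
    have hη0 : η ≠ 0 := Complex.exp_ne_zero _
    have ha : twoCos m = η + η⁻¹ := by rw [twoCos, Complex.exp_neg]
    have hζ : IsPrimitiveRoot (η ^ 2) m := by
      have := Complex.isPrimitiveRoot_exp m (by omega)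
      convert this using 1
      rw [hη, ← Complex.exp_nat_mul]
      congr 1
      push_cast
      ring
    refine pow_eq_one_of_cubic _ hge hζ ?_
    have hz : η ^ 2 + (η ^ 2)⁻¹ = twoCos m ^ 2 - 2 := by
      rw [ha]; field_simp; ring
    rw [hz]
    have fix : ∀ y : A → ℂ, y i = 0 → y j = 0 → (geomRefl N i * geomRefl N j - 1) y = 0 := by
      intro y hi hj
      ext1 k
      simp [geomRefl_apply, hi, hj]
    ext1 x
    rw [Module.End.mul_apply]
    apply fix
    all_goals
      simp only [LinearMap.add_apply, LinearMap.sub_apply, LinearMap.smul_apply,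
        Module.End.mul_apply, Pi.add_apply, Pi.sub_apply, Pi.smul_apply, geomRefl_apply,
        Module.End.one_apply, if_true, if_neg hij, if_neg hji, hsymm, ← hm, smul_eq_mul]
      ring

end Representation

lemma simple_injective : Function.Injective cs.simple := by
  intro i j h
  by_contra hij
  have hl := congrArg (cs.lift ⟨_, geomRefl_isLiftable M⟩) h
  rw [cs.lift_apply_simple, cs.lift_apply_simple] at hl
  have := congrFun (LinearMap.congr_fun hl (Pi.single i 1)) i
  rw [geomRefl_apply, geomRefl_apply] at this
  simp [Ne.symm hij] at this

/-! ### The exchange condition -/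

/-- The action of the `i`-th simple reflection on pairs of a group element and a sign. -/
noncomputable def signedConj (i : B) : Function.End (W × ZMod 2) := fun p =>
  (cs.simple i * p.1 * (cs.simple i)⁻¹, p.2 + if p.1 = cs.simple i then 1 else 0)

lemma prod_signedConj_apply (ω : List B) (p : W × ZMod 2) :
    (ω.map (signedConj cs)).prod p =
      (cs.wordProd ω * p.1 * (cs.wordProd ω)⁻¹,
        p.2 + ((cs.rightInvSeq ω).count p.1 : ℕ)) := by
  induction ω with
  | nil => simp [Function.End.one_def]
  | cons i ω ih =>
    rw [List.map_cons, List.prod_cons]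
    change signedConj cs i ((ω.map (signedConj cs)).prod p) = _
    rw [ih, signedConj, CoxeterSystem.rightInvSeq, cs.wordProd_cons, List.count_cons]
    have : (cs.wordProd ω * p.1 * (cs.wordProd ω)⁻¹ = cs.simple i) ↔
        ((cs.wordProd ω)⁻¹ * cs.simple i * cs.wordProd ω == p.1) = true := by
      rw [beq_iff_eq]
      constructor
      · intro h; rw [← h]; group
      · intro h; rw [← h]; group
    ext
    · simp only [mul_inv_rev, mul_assoc]
    · simp only [this]
      push_cast
      ring

lemma prod_map_reverse_alternatingWord {G : Type*} [Monoid G] (f : B → G) (i i' : B) (m : ℕ) :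
    (((CoxeterSystem.alternatingWord i' i (2 * m)).reverse).map f).prod = (f i * f i') ^ m := by
  induction m with
  | zero => simp [CoxeterSystem.alternatingWord]
  | succ m ih =>
    rw [show 2 * (m + 1) = 2 * m + 1 + 1 by ring, CoxeterSystem.alternatingWord_succ',
      CoxeterSystem.alternatingWord_succ', if_neg (by simp), if_pos (by simp), pow_succ]
    simp [List.reverse_cons, ← ih]

lemma even_count_leftInvSeq_alternatingWord (i i' : B) (t : W) :
    Even ((cs.leftInvSeq (CoxeterSystem.alternatingWord i' i (2 * M i i'))).count t) := by
  set m := M i i'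
  set L := cs.leftInvSeq (CoxeterSystem.alternatingWord i' i (2 * m)) with hL
  have hlen : L.length = 2 * m := by simp [hL]
  have hdrop : L.drop m = L.take m := by
    apply List.ext_getElem
    · simp [hlen]; omega
    · intro k h1 h2
      have hk : k < m := by simp [hlen] at h2; omega
      rw [List.getElem_drop, List.getElem_take]
      simp only [hL]
      rw [cs.getElem_leftInvSeq_alternatingWord i' i m (m + k) (by omega),
        cs.getElem_leftInvSeq_alternatingWord i' i m k (by omega),
        cs.prod_alternatingWord_eq_mul_pow, cs.prod_alternatingWord_eq_mul_pow,
        if_neg (by simp), if_neg (by simp),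
        show (2 * (m + k) + 1) / 2 = m + k by omega, show (2 * k + 1) / 2 = k by omega,
        pow_add, cs.simple_mul_simple_pow, one_mul]
  rw [← List.take_append_drop m L, hdrop, List.count_append]
  exact ⟨_, rfl⟩

lemma signedConj_isLiftable : M.IsLiftable (signedConj cs) := by
  intro i i'
  rw [← prod_map_reverse_alternatingWord]
  funext p
  rw [prod_signedConj_apply, cs.rightInvSeq_reverse, List.count_reverse]
  have h1 : cs.wordProd (CoxeterSystem.alternatingWord i' i (2 * M i i')).reverse = 1 := by
    rw [CoxeterSystem.wordProd, prod_map_reverse_alternatingWord, cs.simple_mul_simple_pow]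
  have h2 := even_count_leftInvSeq_alternatingWord cs i i' p.1
  rw [h1, (ZMod.natCast_eq_zero_iff_even).mpr h2]
  simp [Function.End.one_def]

lemma count_rightInvSeq_eq_of_wordProd_eq {ω ω' : List B} (h : cs.wordProd ω = cs.wordProd ω')
    (t : W) : ((cs.rightInvSeq ω).count t : ZMod 2) = ((cs.rightInvSeq ω').count t : ℕ) := by
  have key : ∀ ω : List B, cs.lift ⟨_, signedConj_isLiftable cs⟩ (cs.wordProd ω) =
      (ω.map (signedConj cs)).prod := by
    intro ω
    rw [CoxeterSystem.wordProd, map_list_prod, List.map_map]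
    congr 2
    funext i
    exact cs.lift_apply_simple _ i
  have := congrFun ((key ω).symm.trans ((congrArg _ h).trans (key ω'))) (t, 0)
  rw [prod_signedConj_apply, prod_signedConj_apply] at this
  simpa using congrArg Prod.snd this

lemma simple_mem_rightInvSeq {ω : List B} {i : B} (h : cs.IsRightDescent (cs.wordProd ω) i) :
    cs.simple i ∈ cs.rightInvSeq ω := by
  obtain ⟨ω', hω', hw⟩ := cs.exists_isReduced (cs.wordProd ω * cs.simple i)
  have hprod : cs.wordProd (ω'.concat i) = cs.wordProd ω := by
    rw [cs.wordProd_concat, ← hw, cs.simple_mul_simple_cancel_right]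
  have hred : cs.IsReduced (ω'.concat i) := by
    rw [CoxeterSystem.IsReduced, hprod, List.length_concat, ← hω'.eq, ← hw]
    exact (cs.isRightDescent_iff.mp h).symm
  have hcount := List.count_eq_one_of_mem hred.nodup_rightInvSeq
    (by rw [cs.rightInvSeq_concat]; simp : cs.simple i ∈ cs.rightInvSeq (ω'.concat i))
  have := count_rightInvSeq_eq_of_wordProd_eq cs hprod (cs.simple i)
  rw [hcount] at this
  by_contra hmem
  rw [List.count_eq_zero_of_not_mem hmem] at this
  exact absurd this (by decide)

/-- The exchange condition. -/
lemma exists_simple_mul_eq_wordProd_eraseIdx {ω : List B} {i : B}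
    (h : cs.IsLeftDescent (cs.wordProd ω) i) :
    ∃ k < ω.length, cs.simple i * cs.wordProd ω = cs.wordProd (ω.eraseIdx k) := by
  rw [← cs.isRightDescent_inv_iff, ← cs.wordProd_reverse] at h
  have hmem := simple_mem_rightInvSeq cs h
  rw [cs.rightInvSeq_reverse, List.mem_reverse] at hmem
  obtain ⟨k, hk, hkeq⟩ := List.getElem_of_mem hmem
  refine ⟨k, by simpa using hk, ?_⟩
  rw [← cs.getD_leftInvSeq_mul_wordProd, List.getD_eq_getElem _ _ hk, hkeq]

/-! ### Parabolic subgroups and minimal coset representatives -/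

variable {cs} {J Θ : Set B}

lemma simple_mem_parabolic {j : B} (hj : j ∈ J) : cs.simple j ∈ parabolic cs J :=
  Subgroup.subset_closure ⟨j, hj, rfl⟩

lemma parabolic_mono {K : Set B} (h : J ⊆ K) : parabolic cs J ≤ parabolic cs K :=
  Subgroup.closure_mono (Set.image_mono h)

lemma wordProd_mem_parabolic {ω : List B} (h : ∀ j ∈ ω, j ∈ J) :
    cs.wordProd ω ∈ parabolic cs J :=
  Subgroup.list_prod_mem _ fun x hx => by
    obtain ⟨j, hj, rfl⟩ := List.mem_map.mp hx
    exact simple_mem_parabolic (h j hj)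

lemma exists_word_of_mem_parabolic {u : W} (hu : u ∈ parabolic cs J) :
    ∃ ω : List B, (∀ j ∈ ω, j ∈ J) ∧ cs.wordProd ω = u := by
  induction hu using Subgroup.closure_induction with
  | mem x hx =>
    obtain ⟨j, hj, rfl⟩ := hx
    exact ⟨[j], by simpa using hj, by simp⟩
  | one => exact ⟨[], by simp, by simp⟩
  | mul x y _ _ hx hy =>
    obtain ⟨ω, h, rfl⟩ := hx
    obtain ⟨ω', h', rfl⟩ := hy
    refine ⟨ω ++ ω', fun j hj => ?_, cs.wordProd_append _ _⟩
    rcases List.mem_append.mp hj with hj | hj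
    exacts [h j hj, h' j hj]
  | inv x _ hx =>
    obtain ⟨ω, h, rfl⟩ := hx
    exact ⟨ω.reverse, by simpa using h, cs.wordProd_reverse _⟩

lemma length_wordProd_mul_of_minimal {ω : List B} (hω : ∀ j ∈ ω, j ∈ J)
    (hmin : ∀ ω' : List B, (∀ j ∈ ω', j ∈ J) → cs.wordProd ω' = cs.wordProd ω →
      ω.length ≤ ω'.length)
    {m : W} (hm : ∀ v ∈ parabolic cs J, cs.length m ≤ cs.length (v * m)) :
    cs.length (cs.wordProd ω * m) = ω.length + cs.length m := by
  induction ω with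
  | nil => simp
  | cons i ω ih =>
    have hi : i ∈ J := hω i (by simp)
    have hω' : ∀ j ∈ ω, j ∈ J := fun j hj => hω j (by simp [hj])
    have ih := ih hω' fun ω' h h' => by
      have := hmin (i :: ω') (by simpa [hi] using h) (by rw [cs.wordProd_cons, cs.wordProd_cons, h'])
      simpa using this
    rw [cs.wordProd_cons, mul_assoc, List.length_cons]
    by_cases hd : cs.IsLeftDescent (cs.wordProd ω * m) i
    · exfalso
      obtain ⟨μ, hμ, rfl⟩ := cs.exists_isReduced m
      rw [← cs.wordProd_append] at hd
      obtain ⟨k, hk, hke⟩ := exists_simple_mul_eq_wordProd_eraseIdx cs hd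
      rw [List.length_append] at hk
      rcases Nat.lt_or_ge k ω.length with hkl | hkl
      · rw [List.eraseIdx_append_of_lt_length hkl, cs.wordProd_append, cs.wordProd_append,
          ← mul_assoc, mul_left_inj, ← cs.wordProd_cons] at hke
        have := hmin (ω.eraseIdx k) (fun j hj => hω' j (List.mem_of_mem_eraseIdx hj)) hke.symm
        have h2 := List.length_eraseIdx_le ω k
        simp at this
        omega
      · rw [List.eraseIdx_append_of_length_le hkl, cs.wordProd_append, cs.wordProd_append] at hke
        have hmem : (cs.wordProd ω)⁻¹ * (cs.simple i * cs.wordProd ω) ∈ parabolic cs J :=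
          mul_mem (inv_mem (wordProd_mem_parabolic hω'))
            (mul_mem (simple_mem_parabolic hi) (wordProd_mem_parabolic hω'))
        have := hm _ hmem
        rw [mul_assoc, mul_assoc, hke, inv_mul_cancel_left, hμ.eq] at this
        have h2 := cs.length_wordProd_le (μ.eraseIdx (k - ω.length))
        rw [List.length_eraseIdx_of_lt (by omega)] at h2
        omega
    · rw [cs.not_isLeftDescent_iff.mp hd, ih]
      ring

lemma exists_minimal_word {u : W} (hu : u ∈ parabolic cs J) :
    ∃ ω : List B, (∀ j ∈ ω, j ∈ J) ∧ cs.wordProd ω = u ∧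
      ∀ ω' : List B, (∀ j ∈ ω', j ∈ J) → cs.wordProd ω' = cs.wordProd ω →
        ω.length ≤ ω'.length := by
  obtain ⟨ω, ⟨h1, h2⟩, h3⟩ := (measure List.length).wf.has_min
    {ω : List B | (∀ j ∈ ω, j ∈ J) ∧ cs.wordProd ω = u} (exists_word_of_mem_parabolic hu)
  exact ⟨ω, h1, h2, fun ω' h h' => not_lt.mp (h3 ω' ⟨h, h'.trans h2⟩)⟩

/-- Elements of a parabolic subgroup have reduced words in the generators of that subgroup. -/
lemma exists_isReduced_of_mem_parabolic {u : W} (hu : u ∈ parabolic cs J) :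
    ∃ ω : List B, (∀ j ∈ ω, j ∈ J) ∧ cs.wordProd ω = u ∧ cs.IsReduced ω := by
  obtain ⟨ω, h1, h2, h3⟩ := exists_minimal_word hu
  refine ⟨ω, h1, h2, ?_⟩
  have := length_wordProd_mul_of_minimal h1 h3 (m := 1) (by simp)
  simpa [CoxeterSystem.IsReduced] using this

lemma mem_minLeft_of_length_le {m : W}
    (hm : ∀ v ∈ parabolic cs J, cs.length m ≤ cs.length (v * m)) : m ∈ minLeft cs J := by
  intro u hu
  obtain ⟨ω, h1, rfl, h3⟩ := exists_minimal_word hu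
  have h := length_wordProd_mul_of_minimal h1 h3 (m := 1) (by simp)
  rw [mul_one, cs.length_one, add_zero] at h
  rw [length_wordProd_mul_of_minimal h1 h3 hm, h]

lemma mem_minLeft_of_not_isLeftDescent {x : W} (hx : ∀ j ∈ J, ¬ cs.IsLeftDescent x j) :
    x ∈ minLeft cs J := by
  obtain ⟨_, ⟨v, hv, rfl⟩, hmin⟩ := (measure cs.length).wf.has_min
    ((fun v => v * x) '' (parabolic cs J : Set W)) ⟨_, 1, one_mem _, rfl⟩
  have hm : v * x ∈ minLeft cs J := mem_minLeft_of_length_le fun u hu =>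
    not_lt.mp (hmin _ ⟨u * v, mul_mem hu hv, mul_assoc _ _ _⟩)
  obtain ⟨ω, h1, h2, h3⟩ := exists_isReduced_of_mem_parabolic (inv_mem hv)
  have hxe : x = cs.wordProd ω * (v * x) := by rw [h2, inv_mul_cancel_left]
  cases ω with
  | nil => rw [cs.wordProd_nil, one_mul] at hxe; rw [hxe]; exact hm
  | cons j ω =>
    exfalso
    apply hx j (h1 j (by simp))
    have h4 : cs.length x = ω.length + 1 + cs.length (v * x) := by
      have := hm _ (wordProd_mem_parabolic h1)
      rwa [← hxe, h3.eq] at this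
    have h5 : cs.simple j * x = cs.wordProd ω * (v * x) := by
      nth_rw 1 [hxe]
      rw [cs.wordProd_cons, mul_assoc, cs.simple_mul_simple_cancel_left]
    have h6 := cs.length_mul_le (cs.wordProd ω) (v * x)
    have h7 := cs.length_wordProd_le ω
    rw [CoxeterSystem.IsLeftDescent, h5]
    omega

lemma mem_of_simple_mem_parabolic {j : B} (h : cs.simple j ∈ parabolic cs J) : j ∈ J := by
  obtain ⟨ω, h1, h2, h3⟩ := exists_isReduced_of_mem_parabolic h
  have hlen : ω.length = 1 := by rw [← h3.eq, h2, cs.length_simple]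
  obtain ⟨k, rfl⟩ := List.length_eq_one_iff.mp hlen
  rw [cs.wordProd_singleton] at h2
  rw [← simple_injective cs h2]
  exact h1 k (by simp)

/-- A minimal coset representative times a simple reflection is again one, or stays in the
same coset. -/
lemma mul_simple_mem_minLeft_or {b : W} (hb : b ∈ minLeft cs J) (i : B) :
    b * cs.simple i ∈ minLeft cs J ∨ ∃ k ∈ J, b * cs.simple i = cs.simple k * b := by
  by_cases h : ∀ j ∈ J, ¬ cs.IsLeftDescent (b * cs.simple i) j
  · exact Or.inl (mem_minLeft_of_not_isLeftDescent h)
  push Not at h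
  obtain ⟨k, hk, hd⟩ := h
  refine Or.inr ⟨k, hk, ?_⟩
  obtain ⟨μ, hμ, hbμ⟩ := cs.exists_isReduced b
  have hprod : b * cs.simple i = cs.wordProd (μ ++ [i]) := by
    rw [cs.wordProd_append, cs.wordProd_singleton, hbμ]
  rw [hprod] at hd
  obtain ⟨n, hn, hne⟩ := exists_simple_mul_eq_wordProd_eraseIdx cs hd
  rcases Nat.lt_or_ge n μ.length with hnl | hnl
  · exfalso
    rw [List.eraseIdx_append_of_lt_length hnl, cs.wordProd_append, cs.wordProd_append,
      ← mul_assoc, mul_left_inj, ← hbμ] at hne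
    have h1 := hb _ (simple_mem_parabolic hk)
    have h2 := cs.length_wordProd_le (μ.eraseIdx n)
    rw [← hne, h1, cs.length_simple, List.length_eraseIdx_of_lt hnl, ← hμ.eq, ← hbμ] at h2
    omega
  · rw [List.eraseIdx_append_of_length_le hnl] at hne
    have hn' : n - μ.length = 0 := by simp at hn; omega
    rw [hn', List.eraseIdx_cons_zero, List.append_nil, ← hbμ, ← hprod] at hne
    nth_rw 2 [← hne]
    rw [cs.simple_mul_simple_cancel_left]

lemma eq_and_eq_of_mul_eq_mul {u u' b b' : W} (hu : u ∈ parabolic cs J) (hu' : u' ∈ parabolic cs J)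
    (hb : b ∈ minLeft cs J) (hb' : b' ∈ minLeft cs J) (h : u * b = u' * b') :
    u = u' ∧ b = b' := by
  have h1 := hb _ (mul_mem (inv_mem hu') hu)
  have h2 := hb' _ (mul_mem (inv_mem hu) hu')
  rw [mul_assoc, h, inv_mul_cancel_left] at h1
  rw [mul_assoc, ← h, inv_mul_cancel_left] at h2
  have h3 : u'⁻¹ * u = 1 := cs.length_eq_zero_iff.mp (by omega)
  have h4 : u = u' := (inv_mul_eq_one.mp h3).symm
  subst h4
  exact ⟨rfl, mul_left_cancel h⟩

/-! ### The parabolic subgroup of `Θ ∪ Θ^⊥` as a direct product -/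

lemma parabolic_perp_le : parabolic cs (perp M Θ) ≤ parabolic cs (Θ ∪ perp M Θ) :=
  parabolic_mono Set.subset_union_right

lemma parabolic_le_union : parabolic cs Θ ≤ parabolic cs (Θ ∪ perp M Θ) :=
  parabolic_mono Set.subset_union_left

lemma commute_of_mem_perp {v u : W} (hv : v ∈ parabolic cs Θ)
    (hu : u ∈ parabolic cs (perp M Θ)) : Commute v u := by
  have hle : parabolic cs (perp M Θ) ≤
      Subgroup.centralizer (parabolic cs Θ : Set W) := by
    rw [parabolic, parabolic, Subgroup.centralizer_closure, Subgroup.closure_le]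
    rintro _ ⟨k, hk, rfl⟩
    rw [SetLike.mem_coe, Subgroup.mem_centralizer_iff]
    rintro _ ⟨j, hj, rfl⟩
    have h := cs.simple_mul_simple_pow k j
    rw [hk.2 j hj, pow_two] at h
    have h' := eq_inv_of_mul_eq_one_left h
    rw [mul_inv_rev, cs.inv_simple, cs.inv_simple] at h'
    exact h'.symm
  exact Subgroup.mem_centralizer_iff.mp (hle hu) v hv

lemma exists_mul_of_mem_parabolic_union {w : W} (hw : w ∈ parabolic cs (Θ ∪ perp M Θ)) :
    ∃ v ∈ parabolic cs Θ, ∃ u ∈ parabolic cs (perp M Θ), w = v * u := by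
  induction hw using Subgroup.closure_induction with
  | mem x hx =>
    obtain ⟨j, hj | hj, rfl⟩ := hx
    · exact ⟨_, simple_mem_parabolic hj, 1, one_mem _, by simp⟩
    · exact ⟨1, one_mem _, _, simple_mem_parabolic hj, by simp⟩
  | one => exact ⟨1, one_mem _, 1, one_mem _, by simp⟩
  | mul x y _ _ hx hy =>
    obtain ⟨v, hv, u, hu, rfl⟩ := hx
    obtain ⟨v', hv', u', hu', rfl⟩ := hy
    refine ⟨v * v', mul_mem hv hv', u * u', mul_mem hu hu', ?_⟩
    have := (commute_of_mem_perp hv' hu).eq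
    rw [mul_assoc, ← mul_assoc u, ← this]
    simp only [mul_assoc]
  | inv x _ hx =>
    obtain ⟨v, hv, u, hu, rfl⟩ := hx
    refine ⟨v⁻¹, inv_mem hv, u⁻¹, inv_mem hu, ?_⟩
    rw [(commute_of_mem_perp hv hu).eq, mul_inv_rev]

lemma mem_minLeft_of_mem_perp {u : W} (hu : u ∈ parabolic cs (perp M Θ)) : u ∈ minLeft cs Θ := by
  refine mem_minLeft_of_not_isLeftDescent fun j hj hd => ?_
  obtain ⟨ω, h1, rfl⟩ := exists_word_of_mem_parabolic hu
  obtain ⟨k, -, hke⟩ := exists_simple_mul_eq_wordProd_eraseIdx cs hd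
  have hmem : cs.simple j * cs.wordProd ω ∈ parabolic cs (perp M Θ) := by
    rw [hke]
    exact wordProd_mem_parabolic fun i hi => h1 i (List.mem_of_mem_eraseIdx hi)
  exact (mem_of_simple_mem_parabolic ((Subgroup.mul_mem_cancel_right _ hu).mp hmem)).1 hj

lemma length_mul_of_mem_perp {v u : W} (hv : v ∈ parabolic cs Θ)
    (hu : u ∈ parabolic cs (perp M Θ)) : cs.length (v * u) = cs.length v + cs.length u :=
  mem_minLeft_of_mem_perp hu v hv

lemma eq_one_of_mem_perp {x : W} (hx : x ∈ parabolic cs Θ)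
    (hx' : x ∈ parabolic cs (perp M Θ)) : x = 1 := by
  have h := length_mul_of_mem_perp (inv_mem hx) hx'
  rw [inv_mul_cancel, cs.length_one] at h
  exact cs.length_eq_zero_iff.mp (by omega)

lemma mul_mem_minLeft {u b : W} (hu : u ∈ parabolic cs (perp M Θ))
    (hb : b ∈ minLeft cs (Θ ∪ perp M Θ)) : u * b ∈ minLeft cs Θ := by
  intro v hv
  rw [← mul_assoc, hb _ (mul_mem (parabolic_le_union hv) (parabolic_perp_le hu)),
    hb _ (parabolic_perp_le hu), length_mul_of_mem_perp hv hu, add_assoc]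

/-! ### Normal forms -/

/-- Comparison of the two normal forms of a class. -/
lemma exists_perp_of_simRel {w x a b : W}
    (hw : w ∈ minRight cs (Θ ∪ perp M Θ)) (hx : x ∈ minLeft cs Θ)
    (ha : a ∈ minRight cs Θ) (hb : b ∈ minLeft cs (Θ ∪ perp M Θ))
    (h : simRel cs Θ (w, x) (a, b)) :
    ∃ u ∈ parabolic cs (perp M Θ), a = w * u ∧ x = u * b ∧
      cs.length a = cs.length w + cs.length u := by
  obtain ⟨z, hz, v, hv, rfl : a = w * z, hbe : b = z⁻¹ * v * x⟩ := h
  obtain ⟨y, hy, u, hu, rfl⟩ := exists_mul_of_mem_parabolic_union hz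
  have hcomm := (commute_of_mem_perp hy hu).eq
  have hy1 : y = 1 := by
    have h1 := ha _ (inv_mem hy)
    rw [hcomm, mul_assoc, mul_assoc, mul_inv_cancel, mul_one, hw _ (parabolic_perp_le hu),
      ← hcomm, hw _ hz, length_mul_of_mem_perp hy hu, cs.length_inv] at h1
    exact cs.length_eq_zero_iff.mp (by omega)
  subst hy1
  rw [one_mul] at hbe hz ⊢
  have hv1 : v = 1 := by
    have h1 : v * x = u * b := by rw [hbe]; group
    have h2 : x = v⁻¹ * u * b := by rw [mul_assoc, ← h1, inv_mul_cancel_left]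
    have h3 := hb _ (mul_mem (parabolic_le_union (inv_mem hv)) hz)
    have h4 := hb _ hz
    have h5 := hx _ hv
    rw [← h2, length_mul_of_mem_perp (inv_mem hv) hu, cs.length_inv] at h3
    rw [← h1] at h4
    exact cs.length_eq_zero_iff.mp (by omega)
  subst hv1
  exact ⟨u, hu, rfl, by rw [hbe]; group, hw _ hz⟩

lemma simRel_mul_simple_iff {w x : W} {i : B} :
    simRel cs Θ (w, x * cs.simple i) (w, x) ↔ x * cs.simple i * x⁻¹ ∈ parabolic cs Θ := by
  constructor
  · rintro ⟨u, -, v, hv, h1 : w = w * u, h2 : x = u⁻¹ * v * (x * cs.simple i)⟩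
    have hu : u = 1 := by simpa using h1
    subst hu
    have : x * cs.simple i * x⁻¹ = v⁻¹ := by
      rw [eq_inv_iff_mul_eq_one, mul_eq_one_iff_eq_inv, mul_inv_eq_iff_eq_mul,
        ← mul_right_inj v, mul_inv_cancel_left]
      simpa using h2.symm
    rw [this]
    exact inv_mem hv
  · intro h
    refine ⟨1, one_mem _, _, inv_mem h, (mul_one _).symm, ?_⟩
    group

/-- behaviour of the extended length `l₊₊` (computed on the normal
form I representative) under right multiplication by a simple reflection `σ_i`. -/
theorem statement16 [Finite B] (Θ : Set B) (w₁ w₂ : W) (i : B)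
    (h₁ : w₁ ∈ minRight cs (Θ ∪ perp M Θ)) (h₂ : w₂ ∈ minLeft cs Θ)
    (a b a' b' : W)
    (ha : a ∈ minRight cs Θ) (hb : b ∈ minLeft cs (Θ ∪ perp M Θ))
    (hab : simRel cs Θ (w₁, w₂) (a, b))
    (ha' : a' ∈ minRight cs Θ) (hb' : b' ∈ minLeft cs (Θ ∪ perp M Θ))
    (hab' : simRel cs Θ (w₁, w₂ * cs.simple i) (a', b')) :
    (((cs.length (w₂ * cs.simple i) + 1 = cs.length w₂ ∧
          w₂ * cs.simple i * w₂⁻¹ ∉ parabolic cs (Θ ∪ perp M Θ)) ∨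
        (cs.length (w₂ * cs.simple i) = cs.length w₂ + 1 ∧
          w₂ * cs.simple i * w₂⁻¹ ∈ parabolic cs (perp M Θ)) →
        (cs.length a' : ℤ) - cs.length b' = (cs.length a : ℤ) - cs.length b + 1) ∧
      (w₂ * cs.simple i * w₂⁻¹ ∈ parabolic cs Θ →
        (cs.length a' : ℤ) - cs.length b' = (cs.length a : ℤ) - cs.length b) ∧
      ((cs.length (w₂ * cs.simple i) = cs.length w₂ + 1 ∧
          w₂ * cs.simple i * w₂⁻¹ ∉ parabolic cs (Θ ∪ perp M Θ)) ∨
        (cs.length (w₂ * cs.simple i) + 1 = cs.length w₂ ∧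
          w₂ * cs.simple i * w₂⁻¹ ∈ parabolic cs (perp M Θ)) →
        (cs.length a' : ℤ) - cs.length b' = (cs.length a : ℤ) - cs.length b - 1)) ∧
    ((cs.length a' : ℤ) - cs.length b' = (cs.length a : ℤ) - cs.length b ↔
      simRel cs Θ (w₁, w₂ * cs.simple i) (w₁, w₂)) := by
  obtain ⟨u, hu, rfl, rfl, hla⟩ := exists_perp_of_simRel h₁ h₂ ha hb hab
  have huK := parabolic_perp_le hu
  have hlen := hb _ huK
  have hs := cs.length_mul_simple (u * b) i
  have hr1 : u * b * cs.simple i * (u * b)⁻¹ ≠ 1 := by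
    intro h
    rw [mul_inv_eq_one, mul_eq_left] at h
    simpa [h] using cs.length_simple i
  have hdisj : ∀ hΘ : u * b * cs.simple i * (u * b)⁻¹ ∈ parabolic cs Θ,
      u * b * cs.simple i * (u * b)⁻¹ ∉ parabolic cs (perp M Θ) :=
    fun hΘ h => hr1 (eq_one_of_mem_perp hΘ h)
  have hΘK : u * b * cs.simple i * (u * b)⁻¹ ∈ parabolic cs Θ →
      u * b * cs.simple i * (u * b)⁻¹ ∈ parabolic cs (Θ ∪ perp M Θ) :=
    fun h => parabolic_le_union h
  have hPK : u * b * cs.simple i * (u * b)⁻¹ ∈ parabolic cs (perp M Θ) →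
      u * b * cs.simple i * (u * b)⁻¹ ∈ parabolic cs (Θ ∪ perp M Θ) :=
    fun h => parabolic_perp_le h
  rw [simRel_mul_simple_iff]
  rcases mul_simple_mem_minLeft_or hb i with hbs | ⟨k, hk, hbk⟩
  · have hrK : u * b * cs.simple i * (u * b)⁻¹ ∉ parabolic cs (Θ ∪ perp M Θ) := by
      intro h
      have h' : b * cs.simple i * b⁻¹ ∈ parabolic cs (Θ ∪ perp M Θ) := by
        have := mul_mem (mul_mem (inv_mem huK) h) huK
        convert this using 1
        group
      have := (eq_and_eq_of_mul_eq_mul (one_mem _) h' hbs hb (by group)).2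
      simpa [this] using cs.length_mul_simple_ne b i
    have hx : u * b * cs.simple i ∈ minLeft cs Θ := by
      rw [mul_assoc]
      exact mul_mem_minLeft hu hbs
    obtain ⟨u', hu', rfl, hxe, hla'⟩ := exists_perp_of_simRel h₁ hx ha' hb' hab'
    obtain ⟨rfl, rfl⟩ := eq_and_eq_of_mul_eq_mul huK (parabolic_perp_le hu') hbs hb'
      (by rw [← mul_assoc, hxe])
    have hlen' := hbs _ huK
    rw [← mul_assoc] at hlen'
    have hΘ := mt hΘK hrK
    have hP := mt hPK hrK
    refine ⟨⟨?_, fun h => absurd h hΘ, ?_⟩, fun h => ?_, fun h => absurd h hΘ⟩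
    · rintro (⟨h, -⟩ | ⟨-, h⟩)
      · omega
      · exact absurd h hP
    · rintro (⟨h, -⟩ | ⟨-, h⟩)
      · omega
      · exact absurd h hP
    · omega
  have hre : u * b * cs.simple i * (u * b)⁻¹ = u * cs.simple k * u⁻¹ := by
    rw [mul_assoc u, hbk]
    group
  rcases hk with hk | hk
  · have hΘ : u * b * cs.simple i * (u * b)⁻¹ ∈ parabolic cs Θ := by
      have hkΘ : cs.simple k ∈ parabolic cs Θ := simple_mem_parabolic hk
      rwa [hre, ← (commute_of_mem_perp hkΘ hu).eq, mul_inv_cancel_right]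
    have hab'' : simRel cs Θ (w₁, u * b) (a', b') := by
      obtain ⟨z, hz, v, hv, h1, h2⟩ := hab'
      refine ⟨z, hz, v * (u * b * cs.simple i * (u * b)⁻¹), mul_mem hv hΘ, h1, h2.trans ?_⟩
      group
    obtain ⟨u', hu', rfl, hxe, hla'⟩ := exists_perp_of_simRel h₁ h₂ ha' hb' hab''
    obtain ⟨rfl, rfl⟩ := eq_and_eq_of_mul_eq_mul huK (parabolic_perp_le hu') hb hb' hxe
    refine ⟨⟨?_, fun _ => rfl, ?_⟩, fun _ => hΘ, fun _ => rfl⟩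
    · rintro (⟨-, h⟩ | ⟨-, h⟩)
      · exact absurd (hΘK hΘ) h
      · exact absurd h (hdisj hΘ)
    · rintro (⟨-, h⟩ | ⟨-, h⟩)
      · exact absurd (hΘK hΘ) h
      · exact absurd h (hdisj hΘ)
  · have huk : u * cs.simple k ∈ parabolic cs (perp M Θ) := mul_mem hu (simple_mem_parabolic hk)
    have hP : u * b * cs.simple i * (u * b)⁻¹ ∈ parabolic cs (perp M Θ) := by
      rw [hre]
      exact mul_mem huk (inv_mem hu)
    have hΘ := fun h => hdisj h hP
    have hxk : u * b * cs.simple i = u * cs.simple k * b := by rw [mul_assoc, hbk, mul_assoc]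
    have hx : u * b * cs.simple i ∈ minLeft cs Θ := by
      rw [hxk]
      exact mul_mem_minLeft huk hb
    obtain ⟨u', hu', rfl, hxe, hla'⟩ := exists_perp_of_simRel h₁ hx ha' hb' hab'
    obtain ⟨rfl, rfl⟩ := eq_and_eq_of_mul_eq_mul (parabolic_perp_le huk) (parabolic_perp_le hu')
      hb hb' (hxk.symm.trans hxe)
    have hlen' := hb _ (parabolic_perp_le huk)
    rw [← hxk] at hlen'
    refine ⟨⟨?_, fun h => absurd h hΘ, ?_⟩, fun h => ?_, fun h => absurd h hΘ⟩
    · rintro (⟨-, h⟩ | ⟨h, -⟩)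
      · exact absurd (hPK hP) h
      · omega
    · rintro (⟨-, h⟩ | ⟨h, -⟩)
      · exact absurd (hPK hP) h
      · omega
    · omega

end Paper
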